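/- There exist absolute constants C₁, C₂, C₃ > 0 with the following property. For every matrix X ∈ ℝ^{n×d} admitting ℓ1 Lewis weights w_1,…,w_n (with W = diag(w_1,…,w_n)) and every positive integer N ≥ d, there exists a matrix X' ∈ ℝ^{m'×d} admitting ℓ1 Lewis weights w'_1,…,w'_{m'} (with W' = diag(w'_1,…,w'_{m'})) such that: (i) m' ≤ C₁·d·N; (ii) X'ᵀ W'⁻¹ X' ⪰ Xᵀ W⁻¹ X in the Loewner (positive semidefinite) order; (iii) ‖X'β‖₁ ≤ C₂·‖Xβ‖₁ for all β ∈ ℝ^d; (iv) w'_i ≤ C₃/N for all i ∈ {1,…,m'}. -/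

import Mathlib

open Finset Matrix
open scoped Classical

noncomputable section

/-- The ℓ1 norm of a vector. -/
def l1 {n : ℕ} (v : Fin n → ℝ) : ℝ := ∑ i, |v i|

/-- The matrix `A = ∑ j (1/w j) xⱼ xⱼᵀ` used in the definition of ℓ1 Lewis weights. -/
def lewisMatrix {ι : Type*} [Fintype ι] {d : ℕ}
    (X : Matrix ι (Fin d) ℝ) (w : ι → ℝ) : Matrix (Fin d) (Fin d) ℝ :=
  ∑ j, (w j)⁻¹ • vecMulVec (X j) (X j)

/-- `w` is a family of ℓ1 Lewis weights for `X`. -/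
def IsLewisWeights {ι : Type*} [Fintype ι] {d : ℕ}
    (X : Matrix ι (Fin d) ℝ) (w : ι → ℝ) : Prop :=
  (∀ i, 0 < w i) ∧ IsUnit (lewisMatrix X w) ∧
    ∀ i, (w i) ^ 2 = X i ⬝ᵥ (lewisMatrix X w)⁻¹.mulVec (X i)

/-- The sampling-and-reweighting matrix determined by the sampled indices `ι`. -/
def sampleMatrix {n N : ℕ} (p : Fin n → ℝ) (ι : Fin N → Fin n) :
    Matrix (Fin N) (Fin n) ℝ :=
  fun k j => if j = ι k then (p (ι k))⁻¹ else 0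

/-- Probability of the event `E` under i.i.d. sampling of `N` indices with `P(i) = p i / N`. -/
def eventProb {n : ℕ} (N : ℕ) (p : Fin n → ℝ) (E : (Fin N → Fin n) → Prop) : ℝ :=
  ∑ ι : Fin N → Fin n, if E ι then ∏ k, p (ι k) / N else 0

/-- Expectation (over i.i.d. indices with `P(i) = p i / N` and independent uniform ±1 signs)
of a function of the indices and signs. -/
def rexp {n : ℕ} (N : ℕ) (p : Fin n → ℝ)
    (f : (Fin N → Fin n) → (Fin N → ℝ) → ℝ) : ℝ :=
  ∑ ι : Fin N → Fin n, ∑ s : Fin N → Bool,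
    (∏ k, p (ι k) / N) * (1 / 2 : ℝ) ^ N * f ι (fun k => if s k then 1 else -1)

theorem dotProduct_lewisMatrix_mulVec {ι : Type*} [Fintype ι] {d : ℕ}
    (X : Matrix ι (Fin d) ℝ) (w : ι → ℝ) (β : Fin d → ℝ) :
    β ⬝ᵥ lewisMatrix X w *ᵥ β = ∑ j, (w j)⁻¹ * (X j ⬝ᵥ β) ^ 2 := by
  simp only [lewisMatrix, sum_mulVec, dotProduct_sum, smul_mulVec, vecMulVec_mulVec,
    dotProduct_smul, smul_eq_mul]
  refine Finset.sum_congr rfl fun j _ => ?_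
  rw [op_smul_eq_smul, dotProduct_comm β (X j), smul_eq_mul]
  ring

theorem lewisMatrix_isHermitian {ι : Type*} [Fintype ι] {d : ℕ}
    (X : Matrix ι (Fin d) ℝ) (w : ι → ℝ) : (lewisMatrix X w).IsHermitian := by
  ext i j
  simp [lewisMatrix, Matrix.sum_apply, vecMulVec_apply, mul_comm]

theorem lewisMatrix_eq_transpose_mul {n d : ℕ} (X : Matrix (Fin n) (Fin d) ℝ) (w : Fin n → ℝ) :
    lewisMatrix X w = Xᵀ * diagonal (fun i => (w i)⁻¹) * X := by
  ext i j
  rw [Matrix.mul_apply, lewisMatrix, Matrix.sum_apply]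
  refine Finset.sum_congr rfl fun k _ => ?_
  rw [Matrix.mul_diagonal, Matrix.smul_apply, vecMulVec_apply, smul_eq_mul, transpose_apply]
  ring

theorem lewisMatrix_posDef {ι : Type*} [Fintype ι] {d : ℕ}
    {X : Matrix ι (Fin d) ℝ} {w : ι → ℝ} (hw : ∀ i, 0 < w i)
    (hX : ∀ β : Fin d → ℝ, β ≠ 0 → ∃ j, X j ⬝ᵥ β ≠ 0) : (lewisMatrix X w).PosDef := by
  refine PosDef.of_dotProduct_mulVec_pos (lewisMatrix_isHermitian X w) fun β hβ => ?_
  obtain ⟨j, hj⟩ := hX β hβ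
  rw [star_trivial, dotProduct_lewisMatrix_mulVec]
  refine Finset.sum_pos' (fun i _ => mul_nonneg (inv_nonneg.2 (hw i).le) (sq_nonneg _))
    ⟨j, Finset.mem_univ j, ?_⟩
  have := hw j
  positivity

theorem exists_dotProduct_ne_zero_of_isUnit {ι : Type*} [Fintype ι] {d : ℕ}
    {X : Matrix ι (Fin d) ℝ} {w : ι → ℝ} (h : IsUnit (lewisMatrix X w))
    {β : Fin d → ℝ} (hβ : β ≠ 0) : ∃ j, X j ⬝ᵥ β ≠ 0 := by
  by_contra! hc
  apply hβ
  apply mulVec_injective_of_isUnit h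
  simp only [lewisMatrix, sum_mulVec, smul_mulVec, vecMulVec_mulVec, hc]
  simp

/-- Cauchy–Schwarz for the quadratic form of a positive definite matrix and its dual. -/
theorem Matrix.PosDef.dotProduct_sq_le {d : ℕ} {A : Matrix (Fin d) (Fin d) ℝ} (hA : A.PosDef)
    (x β : Fin d → ℝ) : (x ⬝ᵥ β) ^ 2 ≤ (x ⬝ᵥ A⁻¹ *ᵥ x) * (β ⬝ᵥ A *ᵥ β) := by
  have hdet : IsUnit A.det := (Matrix.isUnit_iff_isUnit_det A).1 hA.isUnit
  have hAy : A *ᵥ (A⁻¹ *ᵥ x) = x := by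
    rw [mulVec_mulVec, Matrix.mul_nonsing_inv _ hdet, one_mulVec]
  have hsymm : (A⁻¹ *ᵥ x) ⬝ᵥ A *ᵥ β = x ⬝ᵥ β := by
    have hT : Aᵀ = A := by simpa [Matrix.IsHermitian] using hA.isHermitian
    rw [dotProduct_mulVec, ← mulVec_transpose, hT, hAy]
  have hquad : ∀ t : ℝ, 0 ≤ (β ⬝ᵥ A *ᵥ β) * (t * t) + (2 * (x ⬝ᵥ β)) * t + x ⬝ᵥ A⁻¹ *ᵥ x := by
    intro t
    have h := hA.posSemidef.dotProduct_mulVec_nonneg (t • β + A⁻¹ *ᵥ x)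
    rw [star_trivial] at h
    simp only [mulVec_add, mulVec_smul, hAy, dotProduct_add, add_dotProduct, dotProduct_smul,
      smul_dotProduct, smul_eq_mul, hsymm] at h
    rw [dotProduct_comm β x, dotProduct_comm (A⁻¹ *ᵥ x) x] at h
    linarith
  have := discrim_le_zero hquad
  rw [discrim] at this
  linarith

theorem Matrix.PosDef.dotProduct_inv_mulVec_anti {d : ℕ} {A B : Matrix (Fin d) (Fin d) ℝ}
    (hA : A.PosDef) (hB : B.PosDef) (h : ∀ β, β ⬝ᵥ A *ᵥ β ≤ β ⬝ᵥ B *ᵥ β) (x : Fin d → ℝ) :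
    x ⬝ᵥ B⁻¹ *ᵥ x ≤ x ⬝ᵥ A⁻¹ *ᵥ x := by
  have hdet : IsUnit B.det := (Matrix.isUnit_iff_isUnit_det B).1 hB.isUnit
  have hBy : B *ᵥ (B⁻¹ *ᵥ x) = x := by
    rw [mulVec_mulVec, Matrix.mul_nonsing_inv _ hdet, one_mulVec]
  have h1 := hA.dotProduct_sq_le x (B⁻¹ *ᵥ x)
  have h2 := h (B⁻¹ *ᵥ x)
  rw [hBy, dotProduct_comm (B⁻¹ *ᵥ x) x] at h2
  have h3 := hA.inv.posSemidef.dotProduct_mulVec_nonneg x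
  have h4 := hB.inv.posSemidef.dotProduct_mulVec_nonneg x
  rw [star_trivial] at h3 h4
  rcases h4.eq_or_lt with h0 | h0
  · rw [← h0]; exact h3
  · have := mul_le_mul_of_nonneg_left h2 h3
    nlinarith

theorem lewisMatrix_dotProduct_anti {ι : Type*} [Fintype ι] {d : ℕ} (X : Matrix ι (Fin d) ℝ)
    {v w : ι → ℝ} (hv : ∀ i, 0 < v i) (hvw : v ≤ w) (β : Fin d → ℝ) :
    β ⬝ᵥ lewisMatrix X w *ᵥ β ≤ β ⬝ᵥ lewisMatrix X v *ᵥ β := by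
  simp only [dotProduct_lewisMatrix_mulVec]
  exact Finset.sum_le_sum fun i _ => mul_le_mul_of_nonneg_right
    (inv_anti₀ (hv i) (hvw i)) (sq_nonneg _)

theorem lewisMatrix_smul {ι : Type*} [Fintype ι] {d : ℕ} (X : Matrix ι (Fin d) ℝ)
    (c : ℝ) (w : ι → ℝ) : lewisMatrix X (c • w) = c⁻¹ • lewisMatrix X w := by
  simp [lewisMatrix, Finset.smul_sum, mul_smul]
  exact Finset.sum_congr rfl fun j _ => smul_comm _ _ _

/-- Lewis weights exist below any supersolution of the fixed point equation
(by the Knaster–Tarski theorem). -/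
theorem exists_isLewisWeights_le {ι : Type*} [Fintype ι] {d : ℕ} {X : Matrix ι (Fin d) ℝ}
    {u : ι → ℝ} (hu : ∀ i, 0 < u i) (hX0 : ∀ i, X i ≠ 0)
    (hX : ∀ β : Fin d → ℝ, β ≠ 0 → ∃ j, X j ⬝ᵥ β ≠ 0)
    (hsup : ∀ i, X i ⬝ᵥ (lewisMatrix X u)⁻¹ *ᵥ X i ≤ u i ^ 2) :
    ∃ w, IsLewisWeights X w ∧ w ≤ u := by
  let F : (ι → ℝ) → ι → ℝ := fun w i => √(X i ⬝ᵥ (lewisMatrix X w)⁻¹ *ᵥ X i)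
  have hFmono : ∀ v w : ι → ℝ, (∀ i, 0 < v i) → v ≤ w → F v ≤ F w := fun v w hv hvw i =>
    Real.sqrt_le_sqrt <| (lewisMatrix_posDef (fun j => (hv j).trans_le (hvw j)) hX
      ).dotProduct_inv_mulVec_anti (lewisMatrix_posDef hv hX)
        (lewisMatrix_dotProduct_anti X hv hvw) _
  have hpos : ∀ w : ι → ℝ, (∀ i, 0 < w i) → ∀ i, 0 < X i ⬝ᵥ (lewisMatrix X w)⁻¹ *ᵥ X i := by
    intro w hw i
    simpa using (lewisMatrix_posDef hw hX).inv.dotProduct_mulVec_pos (hX0 i)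
  have hFu : F u ≤ u := fun i => (Real.sqrt_le_left (hu i).le).2 (hsup i)
  obtain ⟨δ, hδ0, hδ1, hδ⟩ : ∃ δ : ℝ, 0 < δ ∧ δ ≤ 1 ∧ ∀ i, δ * u i ≤ F u i := by
    have hev : ∀ᶠ δ : ℝ in nhdsWithin 0 (Set.Ioi 0), ∀ i, δ * u i ≤ F u i := by
      rw [Filter.eventually_all]
      intro i
      refine nhdsWithin_le_nhds ?_
      have hc : Filter.Tendsto (fun δ : ℝ => δ * u i) (nhds 0) (nhds (0 * u i)) :=
        (continuous_id.mul continuous_const).tendsto 0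
      rw [zero_mul] at hc
      exact hc.eventually_le_const (Real.sqrt_pos.2 (hpos u hu i))
    have h1 : ∀ᶠ δ : ℝ in nhdsWithin 0 (Set.Ioi 0), δ ≤ 1 :=
      nhdsWithin_le_nhds (eventually_le_nhds one_pos)
    obtain ⟨δ, h, h', h''⟩ := (hev.and (h1.and self_mem_nhdsWithin)).exists
    exact ⟨δ, h'', h', h⟩
  let l : ι → ℝ := (δ ^ 2) • u
  have hl : ∀ i, 0 < l i := fun i => mul_pos (pow_pos hδ0 2) (hu i)
  have hlu : l ≤ u := fun i => mul_le_of_le_one_left (hu i).le (pow_le_one₀ hδ0.le hδ1)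
  have hFl : l ≤ F l := by
    intro i
    have hdet : IsUnit (lewisMatrix X u).det :=
      (Matrix.isUnit_iff_isUnit_det _).1 (lewisMatrix_posDef hu hX).isUnit
    have hinv : (lewisMatrix X l)⁻¹ = δ ^ 2 • (lewisMatrix X u)⁻¹ := by
      rw [lewisMatrix_smul]
      refine Matrix.inv_eq_left_inv ?_
      rw [Matrix.smul_mul, Matrix.mul_smul, Matrix.nonsing_inv_mul _ hdet, smul_smul,
        mul_inv_cancel₀ (pow_pos hδ0 2).ne', one_smul]
    have : F l i = δ * F u i := by
      simp only [F, hinv, smul_mulVec, dotProduct_smul, smul_eq_mul]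
      rw [Real.sqrt_mul (sq_nonneg δ), Real.sqrt_sq hδ0.le]
    rw [this]
    calc l i = δ * (δ * u i) := by simp [l]; ring
      _ ≤ δ * F u i := mul_le_mul_of_nonneg_left (hδ i) hδ0.le
  have : Fact (l ≤ u) := ⟨hlu⟩
  let G : Set.Icc l u →o Set.Icc l u :=
    { toFun := fun w => ⟨F w, hFl.trans (hFmono _ _ hl w.2.1),
        (hFmono _ _ (fun i => (hl i).trans_le (w.2.1 i)) w.2.2).trans hFu⟩
      monotone' := fun v w hvw =>
        hFmono _ _ (fun i => (hl i).trans_le (v.2.1 i)) hvw }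
  have hfix : G (OrderHom.lfp G) = OrderHom.lfp G := OrderHom.map_lfp G
  set w := OrderHom.lfp G
  have hw : ∀ i, 0 < (w : ι → ℝ) i := fun i => (hl i).trans_le (w.2.1 i)
  refine ⟨w, ⟨hw, (lewisMatrix_posDef hw hX).isUnit, fun i => ?_⟩, w.2.2⟩
  have hfix' : F w i = (w : ι → ℝ) i := congrFun (congrArg Subtype.val hfix) i
  rw [← hfix', Real.sq_sqrt (hpos _ hw i).le]

theorem IsLewisWeights.sum_eq {ι : Type*} [Fintype ι] {d : ℕ} {X : Matrix ι (Fin d) ℝ}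
    {w : ι → ℝ} (h : IsLewisWeights X w) : ∑ i, w i = d := by
  obtain ⟨hw, hA, hx⟩ := h
  have htr : ∀ i, ((lewisMatrix X w)⁻¹ * ((w i)⁻¹ • vecMulVec (X i) (X i))).trace = w i := by
    intro i
    rw [Matrix.mul_smul, trace_smul, mul_vecMulVec, trace_vecMulVec, dotProduct_comm, ← hx i]
    have := (hw i).ne'
    simp only [smul_eq_mul]
    field_simp
  calc ∑ i, w i = ((lewisMatrix X w)⁻¹ * lewisMatrix X w).trace := by
        conv_rhs => rw [lewisMatrix.eq_1 X w, Matrix.mul_sum, trace_sum]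
        exact (Finset.sum_congr rfl fun i _ => htr i).symm
    _ = d := by
        rw [Matrix.nonsing_inv_mul _ ((Matrix.isUnit_iff_isUnit_det _).1 hA)]
        simp

/-- A finite half-net of the unit ball of the seminorm `‖T ·‖`. -/
theorem exists_half_net {V F : Type*} [AddCommGroup V] [Module ℝ V] [FiniteDimensional ℝ V]
    [NormedAddCommGroup F] [NormedSpace ℝ F] (T : V →ₗ[ℝ] F) :
    ∃ S : Finset V, S.card ≤ 5 ^ Module.finrank ℝ V ∧ (∀ s ∈ S, ‖T s‖ ≤ 1) ∧
      ∀ β, ‖T β‖ ≤ 1 → ∃ s ∈ S, ‖T (β - s)‖ ≤ 1 / 2 := by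
  let P : Finset V → Prop := fun S => (∀ s ∈ S, ‖T s‖ ≤ 1) ∧
    ∀ s ∈ S, ∀ t ∈ S, s ≠ t → 1 / 2 < ‖T (s - t)‖
  have hcard : ∀ S, P S → S.card ≤ 5 ^ Module.finrank ℝ V := by
    rintro S ⟨h1, h2⟩
    let f : V → LinearMap.range T := fun s => (2 : ℝ) • T.rangeRestrict s
    have hsub : ∀ s t, ‖f s - f t‖ = 2 * ‖T (s - t)‖ := by
      intro s t
      simp only [f]
      rw [← smul_sub, ← map_sub, norm_smul]
      simp
    have hinj : Set.InjOn f S := by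
      intro s hs t ht hst
      by_contra hne
      have h3 := h2 s hs t ht hne
      have h4 := hsub s t
      rw [hst, sub_self, norm_zero] at h4
      linarith
    rw [← Finset.card_image_of_injOn hinj]
    refine (Besicovitch.card_le_of_separated _ ?_ ?_).trans
      (Nat.pow_le_pow_right (by norm_num) (LinearMap.finrank_range_le T))
    · simp only [Finset.mem_image]
      rintro _ ⟨s, hs, rfl⟩
      have h3 := h1 s hs
      simp only [f, norm_smul]
      simp
      exact h3
    · simp only [Finset.mem_image]
      rintro _ ⟨s, hs, rfl⟩ _ ⟨t, ht, rfl⟩ hne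
      rw [hsub]
      have := h2 s hs t ht (fun h => hne (by rw [h]))
      linarith
  have hP0 : P ∅ := ⟨by simp, by simp⟩
  let Q : ℕ → Prop := fun k => ∃ S, P S ∧ S.card = k
  obtain ⟨S, hS, hSk⟩ : Q (Nat.findGreatest Q (5 ^ Module.finrank ℝ V)) :=
    Nat.findGreatest_spec (P := Q) (Nat.zero_le _) ⟨∅, hP0, rfl⟩
  refine ⟨S, hcard S hS, hS.1, fun β hβ => ?_⟩
  by_contra! hc
  have hβS : β ∉ S := by
    intro h
    have := hc β h
    simp at this
    linarith
  have hins : P (insert β S) := by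
    refine ⟨fun s hs => ?_, fun s hs t ht hst => ?_⟩
    · rcases Finset.mem_insert.1 hs with rfl | hs
      exacts [hβ, hS.1 s hs]
    · rcases Finset.mem_insert.1 hs with rfl | hs' <;>
        rcases Finset.mem_insert.1 ht with rfl | ht'
      · exact absurd rfl hst
      · exact hc t ht'
      · rw [map_sub, norm_sub_rev, ← map_sub]
        exact hc s hs'
      · exact hS.2 s hs' t ht' hst
  have h5 := Nat.le_findGreatest (P := Q) (hcard _ hins) ⟨_, hins, rfl⟩
  rw [Finset.card_insert_of_notMem hβS, hSk] at h5
  omega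

/-- A finite net of scale `2⁻ᵏ` of the unit ball of the seminorm `‖T ·‖`. -/
theorem exists_dyadic_net {V F : Type*} [AddCommGroup V] [Module ℝ V] [FiniteDimensional ℝ V]
    [NormedAddCommGroup F] [NormedSpace ℝ F] (T : V →ₗ[ℝ] F) (k : ℕ) :
    ∃ S : Finset V, S.card ≤ (5 ^ Module.finrank ℝ V) ^ k ∧ (∀ s ∈ S, ‖T s‖ ≤ 2) ∧
      ∀ β, ‖T β‖ ≤ 1 → ∃ s ∈ S, ‖T (β - s)‖ ≤ (1 / 2) ^ k := by
  suffices h : ∃ S : Finset V, S.card ≤ (5 ^ Module.finrank ℝ V) ^ k ∧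
      (∀ s ∈ S, ‖T s‖ ≤ 2 - 2 * (1 / 2) ^ k) ∧
      ∀ β, ‖T β‖ ≤ 1 → ∃ s ∈ S, ‖T (β - s)‖ ≤ (1 / 2) ^ k by
    obtain ⟨S, h1, h2, h3⟩ := h
    refine ⟨S, h1, fun s hs => (h2 s hs).trans ?_, h3⟩
    have : (0 : ℝ) < (1 / 2) ^ k := by positivity
    linarith
  obtain ⟨S₀, hc₀, hb₀, hn₀⟩ := exists_half_net T
  induction k with
  | zero => exact ⟨{0}, by simp, by simp, fun β hβ => ⟨0, by simp, by simpa using hβ⟩⟩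
  | succ k ih =>
    obtain ⟨S, hc, hb, hn⟩ := ih
    have hr : (0 : ℝ) < (1 / 2) ^ k := by positivity
    refine ⟨(S ×ˢ S₀).image fun q => q.1 + ((1 / 2 : ℝ) ^ k) • q.2, ?_, ?_, ?_⟩
    · refine Finset.card_image_le.trans ?_
      rw [Finset.card_product, pow_succ]
      exact Nat.mul_le_mul hc hc₀
    · simp only [Finset.mem_image, Finset.mem_product]
      rintro _ ⟨⟨s, t⟩, ⟨hs, ht⟩, rfl⟩
      calc ‖T (s + ((1 / 2 : ℝ) ^ k) • t)‖ ≤ ‖T s‖ + (1 / 2) ^ k * ‖T t‖ := by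
            rw [map_add, map_smul]
            refine (norm_add_le _ _).trans_eq ?_
            rw [norm_smul, Real.norm_of_nonneg hr.le]
        _ ≤ (2 - 2 * (1 / 2) ^ k) + (1 / 2) ^ k * 1 :=
            add_le_add (hb s hs) (mul_le_mul_of_nonneg_left (hb₀ t ht) hr.le)
        _ = 2 - 2 * (1 / 2) ^ (k + 1) := by ring
    · intro β hβ
      obtain ⟨s, hs, hs'⟩ := hn β hβ
      obtain ⟨t, ht, ht'⟩ := hn₀ (((1 / 2 : ℝ) ^ k)⁻¹ • (β - s)) (by
        rw [map_smul, norm_smul, Real.norm_of_nonneg (inv_nonneg.2 hr.le), inv_mul_le_iff₀ hr]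
        simpa using hs')
      refine ⟨_, Finset.mem_image_of_mem _ (Finset.mk_mem_product hs ht), ?_⟩
      have heq : β - (s + ((1 / 2 : ℝ) ^ k) • t)
          = ((1 / 2 : ℝ) ^ k) • (((1 / 2 : ℝ) ^ k)⁻¹ • (β - s) - t) := by
        rw [smul_sub, smul_inv_smul₀ hr.ne', sub_sub]
      change ‖T (β - (s + ((1 / 2 : ℝ) ^ k) • t))‖ ≤ _
      rw [heq, map_smul, norm_smul, Real.norm_of_nonneg hr.le, pow_succ]
      exact mul_le_mul_of_nonneg_left ht' hr.le

/-- A bound on a net propagates to the whole space. -/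
theorem norm_le_of_net {V F F' : Type*} [AddCommGroup V] [Module ℝ V]
    [NormedAddCommGroup F] [NormedSpace ℝ F] [NormedAddCommGroup F'] [NormedSpace ℝ F']
    (T : V →ₗ[ℝ] F) (T' : V →ₗ[ℝ] F') {S : Set V} {ε B L : ℝ} (hε : ε < 1)
    (hL : ∀ β, ‖T' β‖ ≤ L * ‖T β‖)
    (hS : ∀ β, ‖T β‖ ≤ 1 → ∃ s ∈ S, ‖T (β - s)‖ ≤ ε) (hB : ∀ s ∈ S, ‖T' s‖ ≤ B) (β : V) :
    ‖T' β‖ ≤ B / (1 - ε) * ‖T β‖ := by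
  have hscale : ∀ M : ℝ, (∀ β, ‖T β‖ ≤ 1 → ‖T' β‖ ≤ M) → ∀ β, ‖T' β‖ ≤ M * ‖T β‖ := by
    intro M hM β
    rcases (norm_nonneg (T β)).eq_or_lt with h0 | h0
    · have := hL β
      rw [← h0, mul_zero] at this ⊢
      exact this
    · have := hM (‖T β‖⁻¹ • β) (by
        rw [map_smul, norm_smul, norm_inv, norm_norm, inv_mul_cancel₀ h0.ne'])
      rw [map_smul, norm_smul, norm_inv, norm_norm, inv_mul_le_iff₀ h0] at this
      linarith
  let I : Set ℝ := (fun β => ‖T' β‖) '' {β | ‖T β‖ ≤ 1}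
  have hne : I.Nonempty := ⟨_, 0, by simp, rfl⟩
  have hbdd : BddAbove I := by
    refine ⟨|L|, ?_⟩
    rintro _ ⟨γ, hγ, rfl⟩
    calc ‖T' γ‖ ≤ L * ‖T γ‖ := hL γ
      _ ≤ |L| * 1 := mul_le_mul (le_abs_self L) hγ (norm_nonneg _) (abs_nonneg _)
      _ = |L| := mul_one _
  have hM : ∀ β, ‖T' β‖ ≤ sSup I * ‖T β‖ := hscale _ fun γ hγ => le_csSup hbdd ⟨γ, hγ, rfl⟩
  have hM0 : 0 ≤ sSup I := le_csSup hbdd ⟨0, by simp, by simp⟩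
  have hself : sSup I ≤ B + ε * sSup I := by
    refine csSup_le hne ?_
    rintro _ ⟨γ, hγ, rfl⟩
    obtain ⟨s, hs, hs'⟩ := hS γ hγ
    calc ‖T' γ‖ = ‖T' s + T' (γ - s)‖ := by rw [← map_add, add_sub_cancel]
      _ ≤ ‖T' s‖ + ‖T' (γ - s)‖ := norm_add_le _ _
      _ ≤ B + sSup I * ‖T (γ - s)‖ := add_le_add (hB s hs) (hM _)
      _ ≤ B + sSup I * ε := by gcongr
      _ = B + ε * sSup I := by ring
  refine (hM β).trans (mul_le_mul_of_nonneg_right ?_ (norm_nonneg _))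
  rw [le_div_iff₀ (by linarith)]
  linarith

/-- First-moment method for `m` independent samples from the distribution `p`. -/
theorem exists_forall_prod_lt_one {n : ℕ} (m : ℕ) {p : Fin n → ℝ} (hp : ∀ i, 0 ≤ p i)
    (hp1 : ∑ i, p i = 1) (G : Finset (Fin n → ℝ)) (hG : ∀ g ∈ G, ∀ i, 0 ≤ g i) {r : ℝ}
    (hr : ∀ g ∈ G, ∑ i, p i * g i ≤ r) (hcard : G.card * r ^ m < 1) :
    ∃ σ : Fin m → Fin n, ∀ g ∈ G, ∏ k, g (σ k) < 1 := by
  have hpow : ∀ f : Fin n → ℝ, ∑ σ : Fin m → Fin n, ∏ k, f (σ k) = (∑ i, f i) ^ m := by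
    intro f
    rw [← Fintype.prod_sum (fun (_ : Fin m) i => f i)]
    simp
  have hlt : ∑ σ : Fin m → Fin n, (∏ k, p (σ k)) * ∑ g ∈ G, ∏ k, g (σ k)
      < ∑ σ : Fin m → Fin n, (∏ k, p (σ k)) * 1 := by
    simp only [mul_one, hpow, hp1, one_pow, Finset.mul_sum, ← Finset.prod_mul_distrib]
    rw [Finset.sum_comm]
    calc ∑ g ∈ G, ∑ σ : Fin m → Fin n, ∏ k, (p (σ k) * g (σ k))
        = ∑ g ∈ G, (∑ i, p i * g i) ^ m :=
          Finset.sum_congr rfl fun g _ => hpow fun i => p i * g i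
      _ ≤ ∑ g ∈ G, r ^ m := Finset.sum_le_sum fun g hg => pow_le_pow_left₀
          (Finset.sum_nonneg fun i _ => mul_nonneg (hp i) (hG g hg i)) (hr g hg) m
      _ < 1 := by simpa using hcard
  obtain ⟨σ, -, hσ⟩ := Finset.exists_lt_of_sum_lt hlt
  refine ⟨σ, fun g hg => ?_⟩
  have h0 : 0 ≤ ∏ k, p (σ k) := Finset.prod_nonneg fun k _ => hp _
  have h1 : ∑ g ∈ G, ∏ k, g (σ k) < 1 := lt_of_mul_lt_mul_left hσ h0
  exact (Finset.single_le_sum (f := fun g : Fin n → ℝ => ∏ k, g (σ k))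
    (fun g hg => Finset.prod_nonneg fun k _ => hG g hg _) hg).trans_lt h1

/-- The linear map into `ℓᵖ` with given coordinate functionals. -/
def toPiLp {V ι : Type*} [AddCommGroup V] [Module ℝ V] (p : ENNReal) (f : ι → V →ₗ[ℝ] ℝ) :
    V →ₗ[ℝ] PiLp p (fun _ : ι => ℝ) :=
  (WithLp.linearEquiv p ℝ (ι → ℝ)).symm.toLinearMap ∘ₗ LinearMap.pi f

theorem norm_toPiLp_one {V ι : Type*} [Fintype ι] [AddCommGroup V] [Module ℝ V]
    (f : ι → V →ₗ[ℝ] ℝ) (β : V) : ‖toPiLp 1 f β‖ = ∑ i, |f i β| := by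
  rw [PiLp.norm_eq_of_nat 1 (by simp)]
  simp [toPiLp]

theorem norm_toPiLp_two_sq {V ι : Type*} [Fintype ι] [AddCommGroup V] [Module ℝ V]
    (f : ι → V →ₗ[ℝ] ℝ) (β : V) : ‖toPiLp 2 f β‖ ^ 2 = ∑ i, (f i β) ^ 2 := by
  rw [PiLp.norm_sq_eq_of_L2]
  simp [toPiLp]

theorem exp_le_one_add_two_mul {y : ℝ} (h0 : 0 ≤ y) (h1 : y ≤ 1) : Real.exp y ≤ 1 + 2 * y := by
  have h := Real.abs_exp_sub_one_sub_id_le (x := y) (by rwa [abs_of_nonneg h0])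
  have := (abs_le.1 h).2
  nlinarith

theorem exp_neg_le_one_sub_half {y : ℝ} (h0 : 0 ≤ y) (h1 : y ≤ 1) :
    Real.exp (-y) ≤ 1 - y / 2 := by
  have h := Real.add_one_le_exp y
  have h2 : Real.exp (-y) ≤ (1 + y)⁻¹ := by
    rw [Real.exp_neg]
    exact inv_anti₀ (by linarith) (by linarith)
  refine h2.trans ?_
  rw [inv_le_iff_one_le_mul₀ (by linarith)]
  nlinarith

theorem sum_mul_exp_sub_le {n : ℕ} {p y : Fin n → ℝ} {δ : ℝ} (hδ : 0 ≤ δ) (hp : ∀ i, 0 ≤ p i)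
    (hp1 : ∑ i, p i = 1) (h0 : ∀ i, 0 ≤ y i) (h1 : ∀ i, y i ≤ 1) (hm : ∑ i, p i * y i ≤ δ) :
    ∑ i, p i * Real.exp (y i - 3 * δ) ≤ Real.exp (-(δ / 64)) := by
  calc ∑ i, p i * Real.exp (y i - 3 * δ)
      ≤ ∑ i, (p i + 2 * (p i * y i)) * Real.exp (-(3 * δ)) := by
        refine Finset.sum_le_sum fun i _ => ?_
        rw [sub_eq_add_neg, Real.exp_add, ← mul_assoc]
        refine mul_le_mul_of_nonneg_right ?_ (Real.exp_pos _).le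
        have := mul_le_mul_of_nonneg_left (exp_le_one_add_two_mul (h0 i) (h1 i)) (hp i)
        linarith
    _ = (1 + 2 * ∑ i, p i * y i) * Real.exp (-(3 * δ)) := by
        rw [← Finset.sum_mul, Finset.sum_add_distrib, hp1, Finset.mul_sum]
    _ ≤ Real.exp (2 * δ) * Real.exp (-(3 * δ)) := by
        refine mul_le_mul_of_nonneg_right ?_ (Real.exp_pos _).le
        linarith [Real.add_one_le_exp (2 * δ)]
    _ ≤ Real.exp (-(δ / 64)) := by
        rw [← Real.exp_add]
        exact Real.exp_le_exp.2 (by linarith)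

theorem sum_mul_exp_neg_le {n : ℕ} {p y : Fin n → ℝ} {δ : ℝ} (hp : ∀ i, 0 ≤ p i)
    (hp1 : ∑ i, p i = 1) (h0 : ∀ i, 0 ≤ y i) (h1 : ∀ i, y i ≤ 1)
    (hm : δ / 16 ≤ ∑ i, p i * y i) :
    ∑ i, p i * Real.exp (δ / 64 - y i) ≤ Real.exp (-(δ / 64)) := by
  calc ∑ i, p i * Real.exp (δ / 64 - y i)
      ≤ ∑ i, (p i - 1 / 2 * (p i * y i)) * Real.exp (δ / 64) := by
        refine Finset.sum_le_sum fun i _ => ?_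
        rw [sub_eq_add_neg, add_comm, Real.exp_add, ← mul_assoc]
        refine mul_le_mul_of_nonneg_right ?_ (Real.exp_pos _).le
        have := mul_le_mul_of_nonneg_left (exp_neg_le_one_sub_half (h0 i) (h1 i)) (hp i)
        linarith
    _ = (1 - 1 / 2 * ∑ i, p i * y i) * Real.exp (δ / 64) := by
        rw [← Finset.sum_mul, Finset.sum_sub_distrib, hp1, Finset.mul_sum]
    _ ≤ Real.exp (-(δ / 32)) * Real.exp (δ / 64) := by
        refine mul_le_mul_of_nonneg_right ?_ (Real.exp_pos _).le
        linarith [Real.add_one_le_exp (-(δ / 32))]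
    _ ≤ Real.exp (-(δ / 64)) := by
        rw [← Real.exp_add]
        exact Real.exp_le_exp.2 (by linarith)

theorem three_mul_net_card_mul_exp_lt_one {d N : ℕ} (hd : 0 < d) (hdN : d ≤ N) :
    3 * ((5 : ℝ) ^ d) ^ 5 * Real.exp (-(16 * N)) < 1 := by
  have h16 : (65536 : ℝ) ≤ Real.exp 16 := by
    have h := pow_le_pow_left₀ (by norm_num) (Real.exp_one_gt_d9.le.trans' (by norm_num :
      (2 : ℝ) ≤ 2.7182818283)) 16
    rw [← Real.exp_nat_mul] at h
    norm_num at h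
    exact h
  have h1 : (65536 : ℝ) ^ d ≤ Real.exp (16 * N) := by
    refine (pow_le_pow_left₀ (by norm_num) h16 d).trans ?_
    rw [← Real.exp_nat_mul]
    have : (d : ℝ) ≤ N := by exact_mod_cast hdN
    exact Real.exp_le_exp.2 (by linarith)
  have h2 : 3 * ((5 : ℝ) ^ d) ^ 5 < 65536 ^ d := by
    calc 3 * ((5 : ℝ) ^ d) ^ 5 = 3 * 3125 ^ d := by
          rw [← pow_mul, mul_comm d 5, pow_mul]; norm_num
      _ ≤ 3 ^ d * 3125 ^ d := by
          gcongr
          exact le_self_pow₀ (by norm_num) hd.ne'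
      _ = 9375 ^ d := by rw [← mul_pow]; norm_num
      _ < 65536 ^ d := pow_lt_pow_left₀ (by norm_num) (by norm_num) hd.ne'
  rw [Real.exp_neg, ← div_eq_mul_inv, div_lt_one (Real.exp_pos _)]
  exact h2.trans_le h1

theorem sum_lt_zero_of_prod_exp_lt_one {ι : Type*} [Fintype ι] {f : ι → ℝ}
    (h : ∏ k, Real.exp (f k) < 1) : ∑ k, f k < 0 := by
  rwa [← Real.exp_sum, Real.exp_lt_one_iff] at h

/-- Sampling functionals proportionally to their weights: the `ℓ¹` norm does not increase and the
`ℓ²` norm does not decrease by more than constant factors. -/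
theorem exists_sample {V : Type*} [AddCommGroup V] [Module ℝ V] [FiniteDimensional ℝ V]
    {n d N : ℕ} (hd : 0 < d) (hdN : d ≤ N) (hV : Module.finrank ℝ V = d)
    {a : Fin n → V →ₗ[ℝ] ℝ} {w : Fin n → ℝ} (hw : ∀ i, 0 < w i) (hsum : ∑ i, w i = d)
    (ha : ∀ i β, (a i β) ^ 2 ≤ ∑ j, w j * (a j β) ^ 2) :
    ∃ σ : Fin (1024 * d * N) → Fin n, ∀ β,
      ∑ k, |a (σ k) β| ≤ 12 * (1024 * N) * ∑ i, w i * |a i β| ∧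
      16 * N * ∑ i, w i * (a i β) ^ 2 ≤ ∑ k, (a (σ k) β) ^ 2 := by
  have hd0 : (0 : ℝ) < d := by exact_mod_cast hd
  have hN0 : (0 : ℝ) < N := by exact_mod_cast hd.trans_le hdN
  let T₁ := toPiLp 1 (fun i => w i • a i)
  let T₂ := toPiLp 2 (fun i => √(w i) • a i)
  have hT₁ : ∀ β, ‖T₁ β‖ = ∑ i, w i * |a i β| := fun β => by
    rw [norm_toPiLp_one]
    exact Finset.sum_congr rfl fun i _ => by
      rw [LinearMap.smul_apply, smul_eq_mul, abs_mul, abs_of_pos (hw i)]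
  have hT₂ : ∀ β, ‖T₂ β‖ ^ 2 = ∑ i, w i * (a i β) ^ 2 := fun β => by
    rw [norm_toPiLp_two_sq]
    exact Finset.sum_congr rfl fun i _ => by
      rw [LinearMap.smul_apply, smul_eq_mul, mul_pow, Real.sq_sqrt (hw i).le]
  have ha₂ : ∀ i β, |a i β| ≤ ‖T₂ β‖ := fun i β =>
    abs_le_of_sq_le_sq (by rw [hT₂]; exact ha i β) (norm_nonneg _)
  have hT₂₁ : ∀ β, ‖T₂ β‖ ≤ ‖T₁ β‖ := by
    intro β
    have h : ‖T₂ β‖ ^ 2 ≤ ‖T₂ β‖ * ‖T₁ β‖ := by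
      rw [hT₂, hT₁, Finset.mul_sum]
      refine Finset.sum_le_sum fun i _ => ?_
      have := mul_le_mul_of_nonneg_left (ha₂ i β) (mul_nonneg (hw i).le (abs_nonneg (a i β)))
      rw [← sq_abs]
      linarith
    rcases (norm_nonneg (T₂ β)).eq_or_lt with h0 | h0
    · rw [← h0]; exact norm_nonneg _
    · rw [sq] at h
      exact le_of_mul_le_mul_left h h0
  obtain ⟨S₁, hc₁, hb₁, hn₁⟩ := exists_dyadic_net T₁ 1
  obtain ⟨S₂, hc₂, hb₂, hn₂⟩ := exists_dyadic_net T₂ 5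
  rw [hV] at hc₁ hc₂
  let δ : ℝ := (d : ℝ)⁻¹
  have hδ : 0 < δ := inv_pos.2 hd0
  let p : Fin n → ℝ := fun i => w i * δ
  have hp : ∀ i, 0 ≤ p i := fun i => mul_nonneg (hw i).le hδ.le
  have hp1 : ∑ i, p i = 1 := by
    rw [← Finset.sum_mul, hsum, mul_inv_cancel₀ hd0.ne']
  have hp₁ : ∀ β, ∑ i, p i * (|a i β| / 2) = δ * ‖T₁ β‖ / 2 := fun β => by
    rw [hT₁, Finset.mul_sum, Finset.sum_div]
    exact Finset.sum_congr rfl fun i _ => by simp only [p]; ring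
  have hp₂ : ∀ β, ∑ i, p i * ((a i β) ^ 2 / 4) = δ * ‖T₂ β‖ ^ 2 / 4 := fun β => by
    rw [hT₂, Finset.mul_sum, Finset.sum_div]
    exact Finset.sum_congr rfl fun i _ => by simp only [p]; ring
  have hle₁ : ∀ s ∈ S₁, ∀ i, |a i s| / 2 ≤ 1 := fun s hs i => by
    linarith [ha₂ i s, hT₂₁ s, hb₁ s hs]
  have hsq₂ : ∀ s ∈ S₂, ‖T₂ s‖ ^ 2 ≤ 4 := fun s hs => by
    nlinarith [hb₂ s hs, norm_nonneg (T₂ s)]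
  have hle₂ : ∀ s ∈ S₂, ∀ i, (a i s) ^ 2 / 4 ≤ 1 := fun s hs i => by
    linarith [ha i s, hT₂ s, hsq₂ s hs]
  let G₁ := S₁.image fun s i => Real.exp (|a i s| / 2 - 3 * δ)
  let G₂ := S₂.image fun s i => Real.exp ((a i s) ^ 2 / 4 - 3 * δ)
  let G₃ := (S₂.filter fun s => 1 / 2 ≤ ‖T₂ s‖).image fun s i =>
    Real.exp (δ / 64 - (a i s) ^ 2 / 4)
  have hcard : ((G₁ ∪ G₂ ∪ G₃).card : ℝ) ≤ 3 * ((5 : ℝ) ^ d) ^ 5 := by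
    have h1 : G₁.card ≤ (5 ^ d) ^ 5 := Finset.card_image_le.trans
      (hc₁.trans (Nat.pow_le_pow_right (by positivity) (by norm_num)))
    have h2 : G₂.card ≤ (5 ^ d) ^ 5 := Finset.card_image_le.trans hc₂
    have h3 : G₃.card ≤ (5 ^ d) ^ 5 :=
      Finset.card_image_le.trans ((Finset.card_filter_le _ _).trans hc₂)
    have h4 := Finset.card_union_le (G₁ ∪ G₂) G₃
    have h5 := Finset.card_union_le G₁ G₂
    have : (G₁ ∪ G₂ ∪ G₃).card ≤ 3 * (5 ^ d) ^ 5 := by omega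
    exact_mod_cast this
  obtain ⟨σ, hσ⟩ := exists_forall_prod_lt_one (1024 * d * N) hp hp1 (G₁ ∪ G₂ ∪ G₃)
    (r := Real.exp (-(δ / 64)))
    (by
      simp only [Finset.mem_union, G₁, G₂, G₃, Finset.mem_image]
      rintro g ((⟨s, -, rfl⟩ | ⟨s, -, rfl⟩) | ⟨s, -, rfl⟩) i <;> exact (Real.exp_pos _).le)
    (by
      simp only [Finset.mem_union, G₁, G₂, G₃, Finset.mem_image, Finset.mem_filter]
      rintro g ((⟨s, hs, rfl⟩ | ⟨s, hs, rfl⟩) | ⟨s, ⟨hs, hs'⟩, rfl⟩)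
      · refine sum_mul_exp_sub_le hδ.le hp hp1 (fun i => by positivity) (hle₁ s hs) ?_
        rw [hp₁]
        nlinarith [hb₁ s hs]
      · refine sum_mul_exp_sub_le hδ.le hp hp1 (fun i => by positivity) (hle₂ s hs) ?_
        rw [hp₂]
        nlinarith [hsq₂ s hs]
      · refine sum_mul_exp_neg_le hp hp1 (fun i => by positivity) (hle₂ s hs) ?_
        rw [hp₂]
        have : 1 / 4 ≤ ‖T₂ s‖ ^ 2 := by nlinarith
        nlinarith)
    (by
      refine lt_of_le_of_lt ?_ (three_mul_net_card_mul_exp_lt_one hd hdN)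
      refine mul_le_mul hcard (le_of_eq ?_) (by positivity) (by positivity)
      rw [← Real.exp_nat_mul]
      congr 1
      simp only [δ]
      push_cast
      field_simp
      norm_num)
  have hmδ : ((1024 * d * N : ℕ) : ℝ) * δ = 1024 * N := by
    simp only [δ]
    push_cast
    field_simp
  let U₁ := toPiLp 1 (fun k => a (σ k))
  let U₂ := toPiLp 2 (fun k => a (σ k))
  have hU₁ : ∀ β, ‖U₁ β‖ = ∑ k, |a (σ k) β| := norm_toPiLp_one _
  have hU₂ : ∀ β, ‖U₂ β‖ ^ 2 = ∑ k, (a (σ k) β) ^ 2 := norm_toPiLp_two_sq _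
  have hU₁S : ∀ s ∈ S₁, ‖U₁ s‖ ≤ 6 * (1024 * N) := fun s hs => by
    have h := sum_lt_zero_of_prod_exp_lt_one (hσ _ (Finset.mem_union_left _
      (Finset.mem_union_left _ (Finset.mem_image_of_mem _ hs))))
    rw [Finset.sum_sub_distrib, ← Finset.sum_div, Finset.sum_const, Finset.card_univ,
      Fintype.card_fin, nsmul_eq_mul, ← hU₁] at h
    linarith
  have hU₂S : ∀ s ∈ S₂, ‖U₂ s‖ ^ 2 ≤ 12 * (1024 * N) := fun s hs => by
    have h := sum_lt_zero_of_prod_exp_lt_one (hσ _ (Finset.mem_union_left _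
      (Finset.mem_union_right _ (Finset.mem_image_of_mem _ hs))))
    rw [Finset.sum_sub_distrib, ← Finset.sum_div, Finset.sum_const, Finset.card_univ,
      Fintype.card_fin, nsmul_eq_mul, ← hU₂] at h
    linarith
  have hU₂S' : ∀ s ∈ S₂, 1 / 2 ≤ ‖T₂ s‖ → 1024 * N / 16 ≤ ‖U₂ s‖ ^ 2 := fun s hs hs' => by
    have h := sum_lt_zero_of_prod_exp_lt_one (hσ _ (Finset.mem_union_right _
      (Finset.mem_image_of_mem _ (Finset.mem_filter.2 ⟨hs, hs'⟩))))
    rw [Finset.sum_sub_distrib, Finset.sum_const, Finset.card_univ, Fintype.card_fin,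
      nsmul_eq_mul, ← Finset.sum_div, ← hU₂] at h
    linarith
  let ρ : ℝ := √(1024 * N)
  have hρ : ρ ^ 2 = 1024 * N := Real.sq_sqrt (by positivity)
  have hρ0 : 0 < ρ := Real.sqrt_pos.2 (by positivity)
  have hupper₁ : ∀ β, ‖U₁ β‖ ≤ 6 * (1024 * N) / (1 - (1 / 2) ^ 1) * ‖T₁ β‖ := by
    refine norm_le_of_net T₁ U₁ (S := S₁) (L := (1024 * d * N : ℕ)) (by norm_num)
      (fun β => ?_) hn₁ hU₁S
    rw [hU₁]
    calc ∑ k, |a (σ k) β| ≤ ∑ _k : Fin (1024 * d * N), ‖T₁ β‖ :=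
          Finset.sum_le_sum fun k _ => (ha₂ _ β).trans (hT₂₁ β)
      _ = (1024 * d * N : ℕ) * ‖T₁ β‖ := by simp
  have hupper₂ : ∀ β, ‖U₂ β‖ ≤ 7 / 2 * ρ / (1 - (1 / 2) ^ 5) * ‖T₂ β‖ := by
    refine norm_le_of_net T₂ U₂ (S := S₂) (L := √(1024 * d * N : ℕ)) (by norm_num)
      (fun β => ?_) hn₂ (fun s hs => ?_)
    · refine le_of_sq_le_sq ?_ (by positivity)
      rw [mul_pow, Real.sq_sqrt (Nat.cast_nonneg _), hU₂]
      calc ∑ k, (a (σ k) β) ^ 2 ≤ ∑ _k : Fin (1024 * d * N), ‖T₂ β‖ ^ 2 :=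
            Finset.sum_le_sum fun k _ => (ha _ β).trans_eq (hT₂ β).symm
        _ = (1024 * d * N : ℕ) * ‖T₂ β‖ ^ 2 := by simp
    · refine le_of_sq_le_sq ?_ (by positivity)
      rw [mul_pow, hρ]
      linarith [hU₂S s hs]
  have hlower_unit : ∀ β, ‖T₂ β‖ = 1 → ρ / 8 ≤ ‖U₂ β‖ := by
    intro β hβ
    obtain ⟨s, hs, hs'⟩ := hn₂ β hβ.le
    have hs32 : ‖T₂ (β - s)‖ ≤ 1 / 32 := hs'.trans_eq (by norm_num)
    have h1 : ‖T₂ β‖ - ‖T₂ s‖ ≤ ‖T₂ (β - s)‖ := by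
      rw [map_sub]; exact norm_sub_norm_le _ _
    have h2 : ρ / 4 ≤ ‖U₂ s‖ := by
      refine le_of_sq_le_sq ?_ (norm_nonneg _)
      rw [div_pow, hρ]
      have := hU₂S' s hs (by linarith)
      linarith
    have h3 := hupper₂ (β - s)
    have h4 : ‖U₂ s‖ - ‖U₂ β‖ ≤ ‖U₂ (β - s)‖ := by
      rw [map_sub, norm_sub_rev]; exact norm_sub_norm_le _ _
    have h5 : 7 / 2 * ρ / (1 - (1 / 2) ^ 5) * ‖T₂ (β - s)‖
        ≤ 7 / 2 * ρ / (1 - (1 / 2) ^ 5) * (1 / 32) :=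
      mul_le_mul_of_nonneg_left hs32 (div_nonneg (by positivity) (by norm_num))
    have h6 : 7 / 2 * ρ / (1 - (1 / 2) ^ 5) * (1 / 32) = 7 / 62 * ρ := by ring
    linarith
  have hlower : ∀ β, ρ / 8 * ‖T₂ β‖ ≤ ‖U₂ β‖ := by
    intro β
    rcases (norm_nonneg (T₂ β)).eq_or_lt with h0 | h0
    · rw [← h0, mul_zero]; exact norm_nonneg _
    · have := hlower_unit (‖T₂ β‖⁻¹ • β) (by
        rw [map_smul, norm_smul, norm_inv, norm_norm, inv_mul_cancel₀ h0.ne'])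
      rw [map_smul, norm_smul, norm_inv, norm_norm, le_inv_mul_iff₀ h0] at this
      linarith
  refine ⟨σ, fun β => ⟨?_, ?_⟩⟩
  · rw [← hU₁, ← hT₁]
    have := hupper₁ β
    norm_num at this ⊢
    linarith
  · rw [← hU₂, ← hT₂]
    have := pow_le_pow_left₀ (by positivity) (hlower β) 2
    rw [mul_pow, div_pow, hρ] at this
    linarith

/-- Construction of a companion matrix `X'` with few rows, dominating quadratic form,
comparable ℓ1 norms, and uniformly small Lewis weights. -/
theorem stmt10 :
    ∃ C₁ C₂ C₃ : ℝ, 0 < C₁ ∧ 0 < C₂ ∧ 0 < C₃ ∧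
      ∀ (n d : ℕ) (X : Matrix (Fin n) (Fin d) ℝ) (w : Fin n → ℝ),
        IsLewisWeights X w →
        ∀ N : ℕ, 0 < N → d ≤ N →
          ∃ (m' : ℕ) (X' : Matrix (Fin m') (Fin d) ℝ) (w' : Fin m' → ℝ),
            IsLewisWeights X' w' ∧
            (m' : ℝ) ≤ C₁ * d * N ∧
            (X'ᵀ * diagonal (fun i => (w' i)⁻¹) * X' -
              Xᵀ * diagonal (fun i => (w i)⁻¹) * X).PosSemidef ∧
            (∀ β : Fin d → ℝ, l1 (X'.mulVec β) ≤ C₂ * l1 (X.mulVec β)) ∧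
            (∀ i, w' i ≤ C₃ / N) := by
  refine ⟨1024, 768, 1 / 16, by norm_num, by norm_num, by norm_num, ?_⟩
  intro n d X w hXw N hN hdN
  obtain ⟨hw, hA, hx⟩ := id hXw
  have hspan : ∀ β : Fin d → ℝ, β ≠ 0 → ∃ j, X j ⬝ᵥ β ≠ 0 := fun β hβ =>
    exists_dotProduct_ne_zero_of_isUnit hA hβ
  rcases Nat.eq_zero_or_pos d with rfl | hd
  · refine ⟨0, 0, 0, ⟨fun i => i.elim0, isUnit_of_subsingleton _, fun i => i.elim0⟩, by simp,
      PosSemidef.of_dotProduct_mulVec_nonneg (Subsingleton.elim _ _) fun β => by simp,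
      fun β => ?_, fun i => i.elim0⟩
    simp only [l1, Finset.univ_eq_empty, Finset.sum_empty]
    positivity
  have hApd := lewisMatrix_posDef hw hspan
  have hN0 : (0 : ℝ) < N := by exact_mod_cast hN
  let a : Fin n → (Fin d → ℝ) →ₗ[ℝ] ℝ := fun i => (w i)⁻¹ • dotProductBilin ℝ ℝ (X i)
  have ha_apply : ∀ i β, a i β = (w i)⁻¹ * (X i ⬝ᵥ β) := fun i β => rfl
  have hquad : ∀ β, ∑ j, w j * (a j β) ^ 2 = β ⬝ᵥ lewisMatrix X w *ᵥ β := fun β => by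
    rw [dotProduct_lewisMatrix_mulVec]
    refine Finset.sum_congr rfl fun j _ => ?_
    have := (hw j).ne'
    rw [ha_apply]
    field_simp
  have hl1 : ∀ β, ∑ j, w j * |a j β| = l1 (X *ᵥ β) := fun β => by
    refine Finset.sum_congr rfl fun j _ => ?_
    rw [ha_apply, abs_mul, abs_of_pos (inv_pos.2 (hw j)), mul_inv_cancel_left₀ (hw j).ne']
    rfl
  have ha : ∀ i β, (a i β) ^ 2 ≤ ∑ j, w j * (a j β) ^ 2 := by
    intro i β
    have h := hApd.dotProduct_sq_le (X i) β
    rw [← hx i] at h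
    rw [hquad, ha_apply, mul_pow, inv_pow, inv_mul_le_iff₀ (pow_pos (hw i) 2)]
    exact h
  obtain ⟨σ, hσ⟩ := exists_sample hd hdN (by simp) hw hXw.sum_eq ha
  let c : ℝ := 1 / 16 / N
  have hc : 0 < c := by positivity
  let X' : Matrix (Fin (1024 * d * N)) (Fin d) ℝ := fun k => (c * (w (σ k))⁻¹) • X (σ k)
  have hX' : ∀ k β, X' k ⬝ᵥ β = c * a (σ k) β := fun k β => by
    rw [ha_apply, ← mul_assoc]
    exact smul_dotProduct _ _ _
  let u : Fin (1024 * d * N) → ℝ := fun _ => c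
  have hdom : ∀ β, β ⬝ᵥ lewisMatrix X w *ᵥ β ≤ β ⬝ᵥ lewisMatrix X' u *ᵥ β := by
    intro β
    have h : β ⬝ᵥ lewisMatrix X' u *ᵥ β = c * ∑ k, (a (σ k) β) ^ 2 := by
      rw [dotProduct_lewisMatrix_mulVec, Finset.mul_sum]
      refine Finset.sum_congr rfl fun k _ => ?_
      simp only [hX', u]
      field_simp
    rw [h, ← hquad]
    calc ∑ j, w j * (a j β) ^ 2 = c * (16 * N * ∑ j, w j * (a j β) ^ 2) := by
          simp only [c]
          field_simp
      _ ≤ c * ∑ k, (a (σ k) β) ^ 2 := mul_le_mul_of_nonneg_left (hσ β).2 hc.le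
  have hspan' : ∀ β : Fin d → ℝ, β ≠ 0 → ∃ k, X' k ⬝ᵥ β ≠ 0 := by
    intro β hβ
    by_contra! hzero
    have h1 := hApd.dotProduct_mulVec_pos hβ
    rw [star_trivial] at h1
    have h2 := hdom β
    rw [dotProduct_lewisMatrix_mulVec X'] at h2
    simp only [hzero] at h2
    simp at h2
    linarith
  have hXne : ∀ i, X i ≠ 0 := by
    intro i h
    have h1 := hx i
    rw [h, zero_dotProduct] at h1
    exact (pow_pos (hw i) 2).ne' h1
  have hX'ne : ∀ k, X' k ≠ 0 := fun k =>
    smul_ne_zero (mul_pos hc (inv_pos.2 (hw _))).ne' (hXne _)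
  obtain ⟨w', hw', hw'u⟩ := exists_isLewisWeights_le (X := X') (u := u) (fun _ => hc) hX'ne hspan'
    (by
      intro k
      refine (hApd.dotProduct_inv_mulVec_anti (lewisMatrix_posDef (fun _ => hc) hspan') hdom
        _).trans_eq ?_
      have := (hw (σ k)).ne'
      simp only [X', u, mulVec_smul, dotProduct_smul, smul_dotProduct, smul_eq_mul, ← hx]
      field_simp)
  refine ⟨1024 * d * N, X', w', hw', by push_cast; exact le_rfl, ?_, fun β => ?_, hw'u⟩
  · rw [← lewisMatrix_eq_transpose_mul, ← lewisMatrix_eq_transpose_mul]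
    refine PosSemidef.of_dotProduct_mulVec_nonneg
      ((lewisMatrix_isHermitian _ _).sub (lewisMatrix_isHermitian _ _)) fun β => ?_
    rw [star_trivial, sub_mulVec, dotProduct_sub, sub_nonneg]
    exact (hdom β).trans (lewisMatrix_dotProduct_anti X' hw'.1 hw'u β)
  · calc l1 (X' *ᵥ β) = c * ∑ k, |a (σ k) β| := by
          rw [l1, Finset.mul_sum]
          refine Finset.sum_congr rfl fun k _ => ?_
          change |X' k ⬝ᵥ β| = _
          rw [hX', abs_mul, abs_of_pos hc]
      _ ≤ c * (12 * (1024 * N) * ∑ i, w i * |a i β|) :=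
          mul_le_mul_of_nonneg_left (hσ β).1 hc.le
      _ = 768 * l1 (X *ᵥ β) := by
          rw [hl1]
          simp only [c]
          field_simp
          ring
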